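/- (Exponential-weighting regret bound; quantitative core of Theorem 3.) Fix positive integers n, N, T. Let d_1, …, d_T ∈ [−1,1]^n be target vectors and, for each expert j ∈ {1,…,N} and each time t, let x_{j,t} ∈ [−1,1]^n be the expert's prediction. Define weights by w_{j,1} = 1/N and w_{j,t+1} = w_{j,t} · exp( −‖d_t − x_{j,t}‖² / (8n) ), and the aggregated prediction d̂_t = (Σ_{j=1}^N w_{j,t} x_{j,t}) / (Σ_{k=1}^N w_{k,t}). Then for every expert j, Σ_{t=1}^T ‖d_t − d̂_t‖² ≤ Σ_{t=1}^T ‖d_t − x_{j,t}‖² + 8·n·ln N. -/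

import Mathlib

open Finset

/-- The tangent-line inequality for the concave function `t ↦ exp (-t ^ 2 / 2)` on `[0, 1]`,
at a point `s` of that interval. -/
theorem exp_half_sq_sub_sq_le {s t : ℝ} (hs0 : 0 ≤ s) (hs1 : s ≤ 1) (ht1 : t ≤ 1) :
    Real.exp ((s ^ 2 - t ^ 2) / 2) ≤ 1 + s ^ 2 - s * t := by
  have hpos : 0 < 1 + s ^ 2 - s * t := by nlinarith [sq_nonneg (s - t)]
  rw [← Real.le_log_iff_exp_le hpos]
  rcases le_total t s with hts | hst
  · have ha : 0 ≤ s * (s - t) := mul_nonneg hs0 (sub_nonneg.2 hts)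
    have hlog := Real.le_log_one_add_of_nonneg ha
    rw [show 1 + s * (s - t) = 1 + s ^ 2 - s * t by ring] at hlog
    refine le_trans ?_ hlog
    rw [le_div_iff₀ (by linarith)]
    have hsq : (s * (s - t)) ^ 2 ≤ (s - t) ^ 2 := by
      rw [mul_pow]
      exact mul_le_of_le_one_left (sq_nonneg _) (pow_le_one₀ hs0 hs1)
    nlinarith [mul_nonneg ha (sq_nonneg (s * (s - t))), mul_le_mul_of_nonneg_left hsq ha]
  · have hle : 1 + s ^ 2 - s * t ≤ 1 := by nlinarith
    have hsinh := Real.self_le_sinh_iff.2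
      (Real.log_nonneg ((one_le_inv₀ hpos).2 hle))
    rw [Real.sinh_log (inv_pos.2 hpos), Real.log_inv, inv_inv] at hsinh
    have hinv : (1 + s ^ 2 - s * t)⁻¹ ≤ t ^ 2 - s ^ 2 + (1 + s ^ 2 - s * t) := by
      rw [inv_le_iff_one_le_mul₀ hpos]
      nlinarith [mul_nonneg (sq_nonneg (t - s)) (show 0 ≤ 1 - s * t by nlinarith)]
    linarith

section InnerProductSpace

variable {E : Type*} [NormedAddCommGroup E] [InnerProductSpace ℝ E]

theorem exp_half_norm_sq_sub_norm_sq_le {u v : E} (hu : ‖u‖ ≤ 1) (hv : ‖v‖ ≤ 1) :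
    Real.exp ((‖u‖ ^ 2 - ‖v‖ ^ 2) / 2) ≤ 1 + ‖u‖ ^ 2 - inner ℝ u v := by
  have h := exp_half_sq_sub_sq_le (norm_nonneg u) hu hv
  linarith [real_inner_le_norm u v]

/-- Jensen's inequality for the Gaussian `exp (-‖z‖ ^ 2 / 2)`, concave on the unit ball. -/
theorem sum_mul_exp_neg_half_norm_sq_le {ι : Type*} (S : Finset ι) (p : ι → ℝ) (z : ι → E)
    (hp : ∀ i ∈ S, 0 ≤ p i) (hp1 : ∑ i ∈ S, p i = 1) (hz : ∀ i ∈ S, ‖z i‖ ≤ 1) :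
    ∑ i ∈ S, p i * Real.exp (-‖z i‖ ^ 2 / 2) ≤ Real.exp (-‖∑ i ∈ S, p i • z i‖ ^ 2 / 2) := by
  set m := ∑ i ∈ S, p i • z i with hm
  have hm1 : ‖m‖ ≤ 1 := by
    simpa using (convex_closedBall (0 : E) 1).sum_mem hp hp1 (fun i hi => by simpa using hz i hi)
  have hinner : ∑ i ∈ S, p i * inner ℝ m (z i) = ‖m‖ ^ 2 := by
    rw [← real_inner_self_eq_norm_sq]
    nth_rewrite 3 [hm]
    simp [inner_sum, inner_smul_right]
  calc ∑ i ∈ S, p i * Real.exp (-‖z i‖ ^ 2 / 2)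
      ≤ ∑ i ∈ S, p i * (Real.exp (-‖m‖ ^ 2 / 2) * (1 + ‖m‖ ^ 2 - inner ℝ m (z i))) := by
        refine Finset.sum_le_sum fun i hi => mul_le_mul_of_nonneg_left ?_ (hp i hi)
        rw [show -‖z i‖ ^ 2 / 2 = -‖m‖ ^ 2 / 2 + (‖m‖ ^ 2 - ‖z i‖ ^ 2) / 2 by ring, Real.exp_add]
        exact mul_le_mul_of_nonneg_left (exp_half_norm_sq_sub_norm_sq_le hm1 (hz i hi))
          (Real.exp_pos _).le
    _ = Real.exp (-‖m‖ ^ 2 / 2) *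
          ((1 + ‖m‖ ^ 2) * ∑ i ∈ S, p i - ∑ i ∈ S, p i * inner ℝ m (z i)) := by
        rw [Finset.mul_sum, ← Finset.sum_sub_distrib, Finset.mul_sum]
        exact Finset.sum_congr rfl fun i _ => by ring
    _ = Real.exp (-‖m‖ ^ 2 / 2) := by rw [hp1, hinner]; ring

/-- Jensen's inequality for a Gaussian on a ball of radius its standard deviation, with
unnormalized weights. -/
theorem sum_mul_exp_neg_norm_sub_sq_le {ι : Type*} (S : Finset ι) (w : ι → ℝ) (y : E) (x : ι → E)
    {R : ℝ} (hR : 0 < R) (hw : ∀ i ∈ S, 0 ≤ w i) (hW : 0 < ∑ i ∈ S, w i)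
    (hx : ∀ i ∈ S, ‖y - x i‖ ≤ R) :
    ∑ i ∈ S, w i * Real.exp (-‖y - x i‖ ^ 2 / (2 * R ^ 2)) ≤
      (∑ i ∈ S, w i) *
        Real.exp (-‖y - (∑ i ∈ S, w i)⁻¹ • ∑ i ∈ S, w i • x i‖ ^ 2 / (2 * R ^ 2)) := by
  set W := ∑ i ∈ S, w i with hWdef
  have hscale (v : E) : -‖R⁻¹ • v‖ ^ 2 / 2 = -‖v‖ ^ 2 / (2 * R ^ 2) := by
    rw [norm_smul, Real.norm_of_nonneg (inv_pos.2 hR).le]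
    field_simp
  have hp1 : ∑ i ∈ S, W⁻¹ * w i = 1 := by
    rw [← Finset.mul_sum, ← hWdef, inv_mul_cancel₀ hW.ne']
  have hmean : ∑ i ∈ S, (W⁻¹ * w i) • R⁻¹ • (y - x i) =
      R⁻¹ • (y - W⁻¹ • ∑ i ∈ S, w i • x i) := by
    simp_rw [smul_comm _ R⁻¹]
    rw [← Finset.smul_sum]
    simp_rw [smul_sub]
    rw [Finset.sum_sub_distrib, ← Finset.sum_smul, hp1, one_smul, Finset.smul_sum, smul_sub]
    simp_rw [mul_smul]
  have h := sum_mul_exp_neg_half_norm_sq_le S (fun i => W⁻¹ * w i) (fun i => R⁻¹ • (y - x i))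
    (fun i hi => mul_nonneg (inv_pos.2 hW).le (hw i hi)) hp1 (fun i hi => by
      rw [norm_smul, Real.norm_of_nonneg (inv_pos.2 hR).le, inv_mul_le_iff₀ hR, mul_one]
      exact hx i hi)
  rw [hmean, hscale] at h
  simp_rw [hscale, mul_assoc] at h
  rwa [← Finset.mul_sum, inv_mul_le_iff₀ hW] at h

end InnerProductSpace

theorem EuclideanSpace.norm_sub_sq_le_of_mem_Icc {n : ℕ} {u v : EuclideanSpace ℝ (Fin n)}
    (hu : ∀ i, u i ∈ Set.Icc (-1 : ℝ) 1) (hv : ∀ i, v i ∈ Set.Icc (-1 : ℝ) 1) :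
    ‖u - v‖ ^ 2 ≤ 4 * n := by
  rw [EuclideanSpace.norm_sq_eq]
  calc ∑ i, ‖(u - v) i‖ ^ 2 ≤ ∑ _i : Fin n, (4 : ℝ) := by
        refine Finset.sum_le_sum fun i _ => ?_
        have h1 := hu i
        have h2 := hv i
        rw [Set.mem_Icc] at h1 h2
        rw [PiLp.sub_apply, Real.norm_eq_abs, sq_abs]
        nlinarith
    _ = 4 * n := by simp [mul_comm]

/-- exponential-weighting regret bound (quantitative core of
Theorem 3).  With weights `w_{j,1} = 1/N`,
`w_{j,t+1} = w_{j,t} exp(-‖d_t - x_{j,t}‖²/(8n))`, and aggregated prediction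
`d̂_t = (Σ_j w_{j,t} x_{j,t}) / (Σ_k w_{k,t})`, for every expert `j`:
`Σ_{t=1}^T ‖d_t - d̂_t‖² ≤ Σ_{t=1}^T ‖d_t - x_{j,t}‖² + 8 n ln N`.
(Time indices start at `0`, which plays the role of time `1`.) -/
theorem exp_weighting_regret (n N T : ℕ) (hn : 0 < n) (hN : 0 < N) (hT : 0 < T)
    (d : ℕ → EuclideanSpace ℝ (Fin n))
    (hd : ∀ t i, d t i ∈ Set.Icc (-1 : ℝ) 1)
    (x : Fin N → ℕ → EuclideanSpace ℝ (Fin n))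
    (hx : ∀ j t i, x j t i ∈ Set.Icc (-1 : ℝ) 1)
    (w : Fin N → ℕ → ℝ)
    (hw0 : ∀ j, w j 0 = 1 / N)
    (hwrec : ∀ j t, w j (t + 1) = w j t * Real.exp (-‖d t - x j t‖ ^ 2 / (8 * n)))
    (dhat : ℕ → EuclideanSpace ℝ (Fin n))
    (hdhat : ∀ t, dhat t = (∑ k, w k t)⁻¹ • ∑ j, w j t • x j t) :
    ∀ j : Fin N,
      ∑ t ∈ Finset.range T, ‖d t - dhat t‖ ^ 2 ≤
        ∑ t ∈ Finset.range T, ‖d t - x j t‖ ^ 2 + 8 * n * Real.log N := by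
  intro j
  have hN' : (0 : ℝ) < N := by exact_mod_cast hN
  have hn' : (0 : ℝ) < n := by exact_mod_cast hn
  have hclosed (k : Fin N) (t : ℕ) :
      w k t = 1 / N * Real.exp (-(∑ τ ∈ range t, ‖d τ - x k τ‖ ^ 2) / (8 * n)) := by
    induction t with
    | zero => simp [hw0]
    | succ t ih =>
      rw [hwrec, ih, sum_range_succ, mul_assoc, ← Real.exp_add]
      congr 2
      ring
  have hpos (k : Fin N) (t : ℕ) : 0 < w k t := by
    rw [hclosed]
    positivity
  have hWpos (t : ℕ) : 0 < ∑ k, w k t := sum_pos (fun k _ => hpos k t) ⟨j, mem_univ j⟩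
  have hR2 : 2 * (2 * √(n : ℝ)) ^ 2 = 8 * n := by
    rw [mul_pow, Real.sq_sqrt hn'.le]
    ring
  have hstep (t : ℕ) : ∑ k, w k (t + 1) ≤
      (∑ k, w k t) * Real.exp (-‖d t - dhat t‖ ^ 2 / (8 * n)) := by
    simp_rw [hwrec, hdhat]
    rw [← hR2]
    refine sum_mul_exp_neg_norm_sub_sq_le univ (fun k => w k t) (d t) (fun k => x k t)
      (by positivity) (fun k _ => (hpos k t).le) (hWpos t) fun k _ => ?_
    refine le_of_sq_le_sq ?_ (by positivity)
    have h := EuclideanSpace.norm_sub_sq_le_of_mem_Icc (hd t) (hx k t)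
    linarith
  have hupper (t : ℕ) : ∑ k, w k t ≤
      Real.exp (-(∑ τ ∈ range t, ‖d τ - dhat τ‖ ^ 2) / (8 * n)) := by
    induction t with
    | zero => simp [hw0, hN'.ne']
    | succ t ih =>
      refine (hstep t).trans
        ((mul_le_mul_of_nonneg_right ih (Real.exp_pos _).le).trans_eq ?_)
      rw [← Real.exp_add, sum_range_succ]
      congr 1
      ring
  have hfinal := (single_le_sum (fun k _ => (hpos k T).le) (mem_univ j)).trans (hupper T)
  rw [hclosed, ← Real.exp_log (one_div_pos.2 hN'), ← Real.exp_add, Real.exp_le_exp, one_div,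
    Real.log_inv, ← sub_nonneg] at hfinal
  have h := mul_nonneg (by positivity : (0 : ℝ) ≤ 8 * n) hfinal
  field_simp at h
  linarith
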